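/- (Foda–Quano–Kirillov) For all integers ν ≥ 1, 1 ≤ s ≤ ν+1, and L ≥ 0, the following identity of polynomials in q holds: Σ over tuples n = (n_1,…,n_ν) of nonnegative integers of q^{N_1²+⋯+N_ν²+N_s+⋯+N_ν} ∏_{i=1}^ν [n_i + L − 2Σ_{l=1}^i N_l − α_{i,s−1} choose n_i]_q equals B^ν_{s,ν+1}(L,q) if L ≢ s + ν (mod 2), and equals B^ν_{2ν+3−s,ν+1}(L,q) if L ≡ s + ν (mod 2). -/

import Mathlib

open scoped Classical

noncomputable section

/-- The q-Pochhammer symbol `(q)_n = ∏_{j=1}^n (1 - q^j)`. -/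
def qP {F : Type*} [Field F] (q : F) (n : ℕ) : F :=
  ∏ j ∈ Finset.range n, (1 - q ^ (j + 1))

/-- The q-binomial coefficient `[N choose k]_q = (q)_N / ((q)_k (q)_{N-k})`
for `0 ≤ k ≤ N`, and `0` otherwise. -/
def qB {F : Type*} [Field F] (q : F) (N k : ℤ) : F :=
  if 0 ≤ k ∧ k ≤ N then qP q N.toNat / (qP q k.toNat * qP q (N - k).toNat) else 0

/-- `NN n i = N_i = n_i + n_{i+1} + ⋯ + n_ν` (indices 1-based; `n ⟨k⟩` is `n_{k+1}`). -/
def NN {ν : ℕ} (n : Fin ν → ℕ) (i : ℕ) : ℕ :=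
  ∑ k : Fin ν, if i ≤ (k : ℕ) + 1 then n k else 0

/-- `α_{i,s} = max(0, i - s)`. -/
def alph (i s : ℕ) : ℤ := max 0 ((i : ℤ) - s)

/-- The exponent `N_1² + ⋯ + N_ν² + N_{s+1} + ⋯ + N_ν`. -/
def expAG (ν s : ℕ) (nn : Fin ν → ℕ) : ℕ :=
  (∑ i ∈ Finset.Icc 1 ν, (NN nn i) ^ 2) + ∑ i ∈ Finset.Icc (s + 1) ν, NN nn i

/-- The polynomial `B^ν_{s,b}(L,q)` of Foda–Quano–Kirillov type. -/
def B {F : Type*} [Field F] (ν : ℕ) (s b : ℤ) (L : ℕ) (q : F) : F :=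
  ∑ᶠ j : ℤ,
    (q ^ (j * ((2 * j + 1) * (2 * (ν : ℤ) + 3) - 2 * s)) *
        qB q (L : ℤ) (((L : ℤ) + b - s) / 2 + j * (2 * (ν : ℤ) + 3)) -
      q ^ ((2 * j + 1) * ((2 * (ν : ℤ) + 3) * j + s)) *
        qB q (L : ℤ) (((L : ℤ) + b + s) / 2 + j * (2 * (ν : ℤ) + 3)))

/-- `jjf j l = j_l` for `1 ≤ l ≤ ν` (and junk value `0` otherwise). -/
def jjf {ν : ℕ} (j : Fin ν → ℕ) (l : ℕ) : ℤ :=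
  if h : l - 1 < ν then (j ⟨l - 1, h⟩ : ℤ) else 0

/-- The q-multinomial coefficient `[L choose a]^(p)_ν`. -/
def qMulti {F : Type*} [Field F] (ν L : ℕ) (a : ℤ) (p : ℕ) (q : F) : F :=
  ∑ᶠ j : Fin ν → ℕ,
    if (∑ l, (j l : ℤ)) = a then
      q ^ ((∑ l ∈ Finset.Icc 2 ν, jjf j (l - 1) * ((L : ℤ) - jjf j l)) -
            ∑ l ∈ Finset.Icc 1 p, jjf j l) *
        qB q (L : ℤ) (jjf j ν) * ∏ l ∈ Finset.Icc 2 ν, qB q (jjf j l) (jjf j (l - 1))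
    else 0

/-- The polynomial `W^ν_{s,b}(L,q)` of Warnaar type. -/
def W {F : Type*} [Field F] (ν : ℕ) (s : ℤ) (b L : ℕ) (q : F) : F :=
  ∑ᶠ j : ℤ,
    (q ^ (j * ((2 * j + 1) * (2 * (ν : ℤ) + 3) - 2 * s)) *
        qMulti ν L (((ν : ℤ) * ((L : ℤ) + 1) - s - b + 1) / 2 + (2 * (ν : ℤ) + 3) * j) b q -
      q ^ ((2 * j + 1) * ((2 * (ν : ℤ) + 3) * j + s)) *
        qMulti ν L (((ν : ℤ) * ((L : ℤ) + 1) + s - b + 1) / 2 + (2 * (ν : ℤ) + 3) * j) b q)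

/-! ### Bressoud lattice paths -/

/-- Step values: `0 ↦ NE (+1)`, `1 ↦ SE (−1)`, `2 ↦ horizontal (0)`. -/
def stepVal : Fin 3 → ℤ := ![1, -1, 0]

/-- Height of the path after `k` steps, starting at height `s`. -/
def hts (s : ℤ) {n : ℕ} (d : Fin n → Fin 3) (k : ℕ) : ℤ :=
  s + ∑ i ∈ Finset.range k, if h : i < n then stepVal (d ⟨i, h⟩) else 0

/-- The vertex `k` is a peak: it is preceded by a NE step and followed by a SE step. -/
def IsPeak {n : ℕ} (d : Fin n → Fin 3) (k : ℕ) : Prop :=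
  ∃ hk : k < n, 1 ≤ k ∧ d ⟨k - 1, Nat.lt_of_le_of_lt (Nat.sub_le k 1) hk⟩ = 0 ∧ d ⟨k, hk⟩ = 1

/-- `d` encodes a Bressoud path from height `s` to height `b` whose peaks have height `≤ ν`:
SE steps only from positive height, horizontal steps only on the x-axis. -/
def ValidPath (ν : ℕ) (s b : ℤ) {n : ℕ} (d : Fin n → Fin 3) : Prop :=
  hts s d n = b ∧
    (∀ k : Fin n, (d k = 1 → 0 < hts s d (k : ℕ)) ∧ (d k = 2 → hts s d (k : ℕ) = 0)) ∧
    (∀ k : ℕ, IsPeak d k → hts s d k ≤ (ν : ℤ))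

/-- The weight of a Bressoud path starting at x-coordinate `M`:
the sum of the x-coordinates of its peaks. -/
def pwt (M : ℤ) {n : ℕ} (d : Fin n → Fin 3) : ℤ :=
  ∑ k ∈ Finset.range (n + 1), if IsPeak d k then M + (k : ℤ) else 0

/-- `C^ν_{M,L}(s,b,q)`: the weighted count of Bressoud paths from `(M,s)` to `(L,b)`
with no peak higher than `ν`. -/
def Cpoly {F : Type*} [Field F] (ν : ℕ) (M L : ℤ) (s b : ℕ) (q : F) : F :=
  ∑ d ∈ Finset.univ.filter (fun d : Fin (L - M).toNat → Fin 3 => ValidPath ν (s : ℤ) (b : ℤ) d),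
    q ^ pwt M d

/-- `t` is an admissible relative height for the peak at vertex `k`. -/
def RelProp (s : ℤ) {n : ℕ} (d : Fin n → Fin 3) (k t : ℕ) : Prop :=
  0 < t ∧ ∃ k' k'' : ℕ, k' < k ∧ k < k'' ∧ k'' ≤ n ∧
    hts s d k' = hts s d k - t ∧ hts s d k'' = hts s d k - t ∧
    ∀ m : ℕ, k' < m → m < k'' → IsPeak d m →
      hts s d m ≤ hts s d k ∧ (hts s d m = hts s d k → k ≤ m)

/-- The relative height of the peak at vertex `k`: the largest `t` with `RelProp`. -/
def relHt (ν : ℕ) (s : ℤ) {n : ℕ} (d : Fin n → Fin 3) (k : ℕ) : ℕ :=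
  Nat.findGreatest (RelProp s d k) (ν + n)

/-- `P^ν_{M,L}(s,b,n)`: Bressoud paths from `(M,s)` to `(L,b)`, peaks of height at most `ν`,
with exactly `nn j` peaks of relative height `j+1`. -/
def Pset (ν : ℕ) (M L : ℤ) (s b : ℤ) (nn : Fin ν → ℕ) : Finset (Fin (L - M).toNat → Fin 3) :=
  Finset.univ.filter (fun d => ValidPath ν s b d ∧
    ∀ j : Fin ν, ((Finset.range ((L - M).toNat + 1)).filter
      (fun k => IsPeak d k ∧ relHt ν s d k = (j : ℕ) + 1)).card = nn j)

/-! ### Gordon lattice paths -/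

/-- `f` encodes a Gordon path of length `n` from height `s` to height `b`:
`f 0 = s`, `f n = b`, adjacent frequencies sum to at most `ν`; values beyond `n` are `0`. -/
def IsGordon (ν n s b : ℕ) (f : ℕ → ℕ) : Prop :=
  f 0 = s ∧ f n = b ∧ (∀ k, k < n → f k + f (k + 1) ≤ ν) ∧ (∀ k, n < k → f k = 0)

/-- The weight `Σ_{j=M+1}^{L-1} j f_j` of a Gordon path starting at x-coordinate `M`. -/
def gwt (M : ℤ) (n : ℕ) (f : ℕ → ℕ) : ℤ :=
  ∑ k ∈ Finset.Ioo 0 n, (M + (k : ℤ)) * (f k : ℤ)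

/-- `G^ν_{M,L}(s,b,q)`: the weighted count of Gordon paths from `(M,s)` to `(L,b)`. -/
def G {F : Type*} [Field F] (ν : ℕ) (M L : ℤ) (s b : ℕ) (q : F) : F :=
  ∑ᶠ f : ℕ → ℕ, if IsGordon ν (L - M).toNat s b f then q ^ gwt M (L - M).toNat f else 0

/-- `F^ν_{s,b}(L,q)` of (2.21). -/
def Fpoly {F : Type*} [Field F] (ν s b L : ℕ) (q : F) : F :=
  ∑ᶠ nn : Fin ν → ℕ, q ^ expAG ν s nn *
    ∏ i : Fin ν, qB q ((nn i : ℤ) + ((i : ℕ) + 1) * (L : ℤ) -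
      2 * (∑ l ∈ Finset.Icc 1 ((i : ℕ) + 1), (NN nn l : ℤ)) -
      alph ((i : ℕ) + 1) s - alph ((i : ℕ) + 1) b) (nn i)

/-- The left-hand side of (4.2): `F` with the extra `−M(N_1+⋯+N_ν)` in the exponent. -/
def FpolyM {F : Type*} [Field F] (ν s b L M : ℕ) (q : F) : F :=
  ∑ᶠ nn : Fin ν → ℕ,
    q ^ ((expAG ν s nn : ℤ) - (M : ℤ) * ∑ i ∈ Finset.Icc 1 ν, (NN nn i : ℤ)) *
    ∏ i : Fin ν, qB q ((nn i : ℤ) + ((i : ℕ) + 1) * (L : ℤ) -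
      2 * (∑ l ∈ Finset.Icc 1 ((i : ℕ) + 1), (NN nn l : ℤ)) -
      alph ((i : ℕ) + 1) s - alph ((i : ℕ) + 1) b) (nn i)


abbrev K : Type := RatFunc ℚ


section helpers

variable {F : Type*} [Field F] {q : F}

lemma qP_succ (q : F) (n : ℕ) : qP q (n + 1) = qP q n * (1 - q ^ (n + 1)) := by
  simp [qP, Finset.prod_range_succ]

lemma qP_ne (hq : ∀ n : ℕ, 1 - q ^ (n + 1) ≠ 0) (n : ℕ) : qP q n ≠ 0 := by
  rw [qP, Finset.prod_ne_zero_iff]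
  intro j _
  exact hq j

lemma qB_of_not {N k : ℤ} (h : ¬ (0 ≤ k ∧ k ≤ N)) : qB q N k = 0 := by
  simp only [qB, if_neg h]

lemma qB_add (a b : ℕ) : qB q ((a : ℤ) + b) a = qP q (a + b) / (qP q a * qP q b) := by
  have h : (0 : ℤ) ≤ a ∧ (a : ℤ) ≤ (a : ℤ) + b := by omega
  rw [qB, if_pos h]
  congr 3
  congr 1
  omega

lemma qB_symm (N k : ℤ) : qB q N k = qB q N (N - k) := by
  by_cases h : 0 ≤ k ∧ k ≤ N
  · rw [qB, qB, if_pos h, if_pos (by omega), mul_comm]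
    congr 3
    congr 1
    omega
  · rw [qB_of_not h, qB_of_not (by omega)]

lemma qB_pascal (hq : ∀ n : ℕ, 1 - q ^ (n + 1) ≠ 0) (N k : ℤ) (h : ¬ (N + 1 = 0 ∧ k = 0)) :
    qB q (N + 1) k = q ^ k * qB q N k + qB q N (k - 1) := by
  have hP := qP_ne hq
  by_cases h1 : 0 ≤ k ∧ k ≤ N + 1
  · obtain ⟨a, rfl⟩ : ∃ a : ℕ, k = a := ⟨k.toNat, by omega⟩
    obtain ⟨b, hb⟩ : ∃ b : ℕ, N + 1 = a + b := ⟨(N + 1 - a).toNat, by omega⟩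
    rw [hb, qB_add]
    rcases a with _ | a
    · rcases b with _ | b
      · exfalso; apply h; simp at hb; simp [hb]
      · rw [qB_of_not (k := ((0 : ℕ) : ℤ) - 1) (by omega)]
        have : N = ((0 : ℕ) : ℤ) + b := by push_cast at hb ⊢; omega
        rw [this, qB_add]
        simp [qP]
        have h2 := hP b
        have h3 := hP (b + 1)
        simp only [qP] at h2 h3
        rw [div_self h2, div_self h3]
    · rcases b with _ | b
      · rw [qB_of_not (k := ((a + 1 : ℕ) : ℤ)) (by push_cast at hb ⊢; omega)]
        have e1 : N = (a : ℤ) + (0 : ℕ) := by push_cast at hb ⊢; omega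
        have e2 : ((a + 1 : ℕ) : ℤ) - 1 = (a : ℤ) := by push_cast; ring
        rw [e2, e1, qB_add]
        have h0 : qP q 0 = 1 := by simp [qP]
        simp only [add_zero, h0, mul_one, mul_zero, zero_add]
        rw [div_self (hP _), div_self (hP _)]
      · have e1 : N = ((a + 1 : ℕ) : ℤ) + b := by push_cast at hb ⊢; omega
        have e3 : N = (a : ℤ) + (b + 1 : ℕ) := by push_cast at hb ⊢; omega
        have e2 : ((a + 1 : ℕ) : ℤ) - 1 = (a : ℤ) := by push_cast; ring
        have f1 : qB q N ((a + 1 : ℕ) : ℤ) = qP q (a + b + 1) / (qP q (a + 1) * qP q b) := by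
          rw [e1, qB_add]; congr 2; ring
        have f2 : qB q N (a : ℤ) = qP q (a + b + 1) / (qP q a * qP q (b + 1)) := by
          rw [e3, qB_add]; congr 2
        rw [e2, f1, f2, zpow_natCast]
        have e4 : a + 1 + (b + 1) = (a + b + 1) + 1 := by ring
        rw [e4, qP_succ q (a + b + 1), qP_succ q a, qP_succ q b]
        have h1 := hP a
        have h2 := hP b
        have h3 := hq a
        have h4 := hq b
        field_simp
        ring
  · rw [qB_of_not h1]
    by_cases h2 : k < 0
    · rw [qB_of_not (by omega), qB_of_not (by omega)]; simp
    · rw [qB_of_not (by omega), qB_of_not (by omega)]; simp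

lemma qB_pascal' (hq : ∀ n : ℕ, 1 - q ^ (n + 1) ≠ 0) (N k : ℤ) (h : ¬ (N + 1 = 0 ∧ k = 0)) :
    qB q (N + 1) k = qB q N k + q ^ (N + 1 - k) * qB q N (k - 1) := by
  rw [qB_symm, qB_pascal hq N (N + 1 - k) (by omega), qB_symm N (N + 1 - k), qB_symm N (N + 1 - k - 1),
    add_comm]
  congr 3 <;> ring

lemma qB_three (hq0 : q ≠ 0) (hq : ∀ n : ℕ, 1 - q ^ (n + 1) ≠ 0) (m : ℕ) (k : ℤ) :
    qB q (m + 1) k = qB q m (k - 1) + qB q m k - (1 - q ^ m) * qB q ((m - 1 : ℕ) : ℤ) (k - 1) := by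
  rcases m with _ | m
  · rw [qB_pascal' hq ((0 : ℕ) : ℤ) k (by omega)]
    by_cases hk : k = 1
    · subst hk; simp; ring
    · rw [qB_of_not (k := k - 1) (by push_cast; omega)]
      simp
  · rw [qB_pascal' hq ((m + 1 : ℕ) : ℤ) k (by omega)]
    have e : ((m + 1 - 1 : ℕ) : ℤ) = (m : ℤ) := by simp
    rw [e]
    have h1 := qB_pascal (q := q) hq (m : ℤ) (k - 1) (by omega)
    have h2 := qB_pascal' (q := q) hq (m : ℤ) (k - 1) (by omega)
    have e2 : ((m + 1 : ℕ) : ℤ) = (m : ℤ) + 1 := by push_cast; ring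
    rw [e2]
    have e3 : (m : ℤ) + 1 + 1 - k = (m : ℤ) + 1 - (k - 1) := by ring
    rw [e3]
    have e4 : q ^ ((m : ℤ) + 1 - (k - 1)) * q ^ (k - 1) = q ^ (m + 1) := by
      rw [← zpow_add₀ hq0]
      have : (m : ℤ) + 1 - (k - 1) + (k - 1) = ((m + 1 : ℕ) : ℤ) := by push_cast; ring
      rw [this, zpow_natCast]
    linear_combination (q ^ ((m : ℤ) + 1 - (k - 1))) * h1 - h2 + qB q m (k-1) * e4

/-! Fermionic side -/

def SS {ν : ℕ} (n : Fin ν → ℕ) (i : ℕ) : ℤ := ∑ l ∈ Finset.Icc 1 i, (NN n l : ℤ)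

def bump {ν : ℕ} (k : Fin ν) (n : Fin ν → ℕ) : Fin ν → ℕ := Function.update n k (n k + 1)

lemma SS_zero {ν : ℕ} (n : Fin ν → ℕ) : SS n 0 = 0 := by simp [SS]

lemma SS_succ {ν : ℕ} (n : Fin ν → ℕ) (i : ℕ) : SS n (i + 1) = SS n i + NN n (i + 1) := by
  rw [SS, Finset.sum_Icc_succ_top (by omega)]; rfl

lemma SS_eq {ν : ℕ} (n : Fin ν → ℕ) (i : ℕ) :
    SS n i = ∑ k : Fin ν, (min (i : ℤ) ((k : ℤ) + 1)) * n k := by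
  induction i with
  | zero =>
    rw [SS_zero]; symm; apply Finset.sum_eq_zero
    intro k _
    have : min ((0 : ℕ) : ℤ) ((k : ℤ) + 1) = 0 := by omega
    rw [this]; simp
  | succ i ih =>
    rw [SS_succ, ih, NN]
    push_cast
    rw [← Finset.sum_add_distrib]
    apply Finset.sum_congr rfl
    intro k _
    split_ifs with h
    · have e1 : min (i : ℤ) ((k : ℤ) + 1) = i := by omega
      have e2 : min ((i : ℤ) + 1) ((k : ℤ) + 1) = i + 1 := by omega
      rw [e1, e2]; ring
    · have e1 : min (i : ℤ) ((k : ℤ) + 1) = k + 1 := by omega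
      have e2 : min ((i : ℤ) + 1) ((k : ℤ) + 1) = k + 1 := by omega
      rw [e1, e2]; ring

lemma NN_bump {ν : ℕ} (k : Fin ν) (n : Fin ν → ℕ) (i : ℕ) :
    NN (bump k n) i = NN n i + if i ≤ (k : ℕ) + 1 then 1 else 0 := by
  have : ∀ j : Fin ν, (if i ≤ (j : ℕ) + 1 then bump k n j else 0) =
      (if i ≤ (j : ℕ) + 1 then n j else 0) +
        if j = k then (if i ≤ (k : ℕ) + 1 then 1 else 0) else 0 := by
    intro j
    by_cases hj : j = k
    · subst hj; simp only [bump, Function.update_self, if_true]; split_ifs <;> simp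
    · simp [bump, hj]
  simp only [NN, this, Finset.sum_add_distrib, Finset.sum_ite_eq', Finset.mem_univ, if_true]

lemma SS_bump {ν : ℕ} (k : Fin ν) (n : Fin ν → ℕ) (i : ℕ) :
    SS (bump k n) i = SS n i + min (i : ℤ) ((k : ℤ) + 1) := by
  induction i with
  | zero => simp only [SS_zero]; omega
  | succ i ih =>
    rw [SS_succ, SS_succ, ih, NN_bump]
    split_ifs <;> push_cast <;> omega

lemma NN_step {ν : ℕ} (n : Fin ν → ℕ) (k : Fin ν) :
    NN n ((k : ℕ) + 1) = n k + NN n ((k : ℕ) + 2) := by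
  have : ∀ j : Fin ν, (if (k : ℕ) + 1 ≤ (j : ℕ) + 1 then n j else 0) =
      (if j = k then n k else 0) + (if (k : ℕ) + 2 ≤ (j : ℕ) + 1 then n j else 0) := by
    intro j
    by_cases hj : j = k
    · subst hj; simp
    · have : (j : ℕ) ≠ k := fun h => hj (Fin.ext h)
      simp only [hj, if_false, zero_add]
      congr 1
      simp only [eq_iff_iff]
      omega
  simp only [NN, this, Finset.sum_add_distrib, Finset.sum_ite_eq', Finset.mem_univ, if_true]

lemma NN_top {ν : ℕ} (n : Fin ν → ℕ) (i : ℕ) (h : ν < i) : NN n i = 0 := by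
  rw [NN]; apply Finset.sum_eq_zero
  intro k _
  rw [if_neg (by omega)]

lemma sq_bump {ν : ℕ} (k : Fin ν) (n : Fin ν → ℕ) :
    ((∑ i ∈ Finset.Icc 1 ν, NN (bump k n) i ^ 2 : ℕ) : ℤ) =
      ((∑ i ∈ Finset.Icc 1 ν, NN n i ^ 2 : ℕ) : ℤ) + 2 * SS n ((k : ℕ) + 1) + ((k : ℕ) + 1) := by
  have hI : (Finset.Icc 1 ν).filter (fun i => i ≤ (k : ℕ) + 1) = Finset.Icc 1 ((k : ℕ) + 1) := by
    ext i; simp only [Finset.mem_filter, Finset.mem_Icc]; omega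
  have h1 : ∀ i, ((NN (bump k n) i : ℕ) : ℤ) ^ 2 = (NN n i : ℤ) ^ 2 +
      if i ≤ (k : ℕ) + 1 then (2 * (NN n i : ℤ) + 1) else 0 := by
    intro i; rw [NN_bump]; split_ifs <;> push_cast <;> ring
  push_cast
  simp only [h1, Finset.sum_add_distrib]
  rw [← Finset.sum_filter, hI, Finset.sum_add_distrib, SS, Finset.mul_sum]
  simp
  ring

/-- general fermionic summand -/
def tm (q : F) (T : ℤ) {ν : ℕ} (l : ℕ → ℤ) (n : Fin ν → ℕ) : F :=
  q ^ (((∑ i ∈ Finset.Icc 1 ν, NN n i ^ 2 : ℕ) : ℤ) + ∑ k : Fin ν, (T - l ((k : ℕ) + 1)) * n k) *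
    ∏ i : Fin ν, qB q ((n i : ℤ) + l ((i : ℕ) + 1) - 2 * SS n ((i : ℕ) + 1)) (n i)

def Ph (q : F) (T : ℤ) (ν : ℕ) (l : ℕ → ℤ) : F := ∑ᶠ n : Fin ν → ℕ, tm q T l n

lemma tm_zero {T : ℤ} {ν : ℕ} {l : ℕ → ℤ} {n : Fin ν → ℕ} (i : Fin ν)
    (h : l ((i : ℕ) + 1) < 2 * SS n ((i : ℕ) + 1)) : tm q T l n = 0 := by
  rw [tm, Finset.prod_eq_zero (Finset.mem_univ i) (qB_of_not (by omega)), mul_zero]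

lemma SS_nonneg {ν : ℕ} (n : Fin ν → ℕ) (i : ℕ) : 0 ≤ SS n i := by
  rw [SS]; exact Finset.sum_nonneg (fun _ _ => by positivity)

lemma le_SS {ν : ℕ} (n : Fin ν → ℕ) (k : Fin ν) : (n k : ℤ) ≤ SS n ν := by
  rw [SS_eq]
  have : (n k : ℤ) ≤ min (ν : ℤ) ((k : ℤ) + 1) * n k := by
    have h1 : (1 : ℤ) ≤ min (ν : ℤ) ((k : ℤ) + 1) := by have := k.2; omega
    nlinarith [Int.natCast_nonneg (n k)]
  refine this.trans ?_
  apply Finset.single_le_sum (f := fun k : Fin ν => min (ν : ℤ) ((k : ℤ) + 1) * (n k : ℤ))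
    (fun j _ => by positivity) (Finset.mem_univ k)

lemma tm_fin (T : ℤ) {ν : ℕ} (hν : 1 ≤ ν) (l : ℕ → ℤ) :
    Function.HasFiniteSupport (fun n : Fin ν → ℕ => tm q T l n) := by
  apply Set.Finite.subset (Set.Finite.pi' (fun _ : Fin ν => Set.finite_Iic (l ν).toNat))
  intro n hn k
  by_contra hc
  apply hn
  have h1 := le_SS n k
  simp only [Set.mem_Iic, not_le] at hc
  apply tm_zero ⟨ν - 1, by omega⟩
  have : (⟨ν - 1, by omega⟩ : Fin ν).val + 1 = ν := by simp; omega
  rw [this]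
  omega

lemma Ph_congr (T : ℤ) (ν : ℕ) {l l' : ℕ → ℤ} (h : ∀ i, 1 ≤ i → i ≤ ν → l i = l' i) :
    Ph q T ν l = Ph q T ν l' := by
  have : ∀ k : Fin ν, l ((k : ℕ) + 1) = l' ((k : ℕ) + 1) := fun k => h _ (by omega) (by omega)
  simp only [Ph, tm, this]

lemma Ph_neg (T : ℤ) {ν : ℕ} {l : ℕ → ℤ} (i : ℕ) (h1 : 1 ≤ i) (h2 : i ≤ ν) (h : l i < 0) :
    Ph q T ν l = 0 := by
  rw [Ph, ← finsum_zero]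
  congr 1; ext n
  apply tm_zero ⟨i - 1, by omega⟩
  have : (⟨i - 1, by omega⟩ : Fin ν).val + 1 = i := by simp; omega
  rw [this]
  have := SS_nonneg n i
  omega

lemma bump_inj {ν : ℕ} (k : Fin ν) : Function.Injective (bump k) := by
  intro a b h
  ext j
  have := congrFun h j
  by_cases hj : j = k
  · subst hj; simpa [bump] using this
  · simpa [bump, hj] using this

lemma mem_bump {ν : ℕ} (k : Fin ν) (n : Fin ν → ℕ) (h : n k ≠ 0) : n ∈ Set.range (bump k) := by
  refine ⟨Function.update n k (n k - 1), ?_⟩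
  ext j
  by_cases hj : j = k
  · subst hj; simp [bump]; omega
  · simp [bump, hj]

lemma tm_bump (hq0 : q ≠ 0) (hq : ∀ n : ℕ, 1 - q ^ (n + 1) ≠ 0) (T : ℤ) {ν : ℕ} (k : Fin ν)
    (l l1 l2 : ℕ → ℤ)
    (h1 : ∀ i, 1 ≤ i → i ≤ ν → l1 i = l i - if i = (k : ℕ) + 1 then 1 else 0)
    (h2 : ∀ i, 1 ≤ i → i ≤ ν → l2 i = l i - 2 * min (i : ℤ) ((k : ℤ) + 1)) (n : Fin ν → ℕ) :
    tm q T l (bump k n) - tm q T l1 (bump k n) =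
      q ^ ((k : ℤ) + 1 + T - l ((k : ℕ) + 1)) * tm q T l2 n := by
  have h1' : ∀ i : Fin ν, l1 ((i : ℕ) + 1) = l ((i : ℕ) + 1) - if i = k then 1 else 0 := by
    intro i; rw [h1 _ (by omega) (by omega)]; congr 2; simp [Fin.ext_iff]
  have h2' : ∀ i : Fin ν, l2 ((i : ℕ) + 1) =
      l ((i : ℕ) + 1) - 2 * min (((i : ℕ) + 1 : ℕ) : ℤ) ((k : ℤ) + 1) := by
    intro i; rw [h2 _ (by omega) (by omega)]
  have hb : ∀ i : Fin ν, ((bump k n i : ℕ) : ℤ) = n i + if i = k then 1 else 0 := by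
    intro i; by_cases hj : i = k
    · subst hj; simp [bump]
    · simp [bump, hj]
  have ex1 : ∑ j : Fin ν, (T - l1 ((j : ℕ) + 1)) * ((bump k n j : ℕ) : ℤ) =
      ∑ j : Fin ν, (T - l ((j : ℕ) + 1)) * ((bump k n j : ℕ) : ℤ) + (n k + 1) := by
    have : ∀ j : Fin ν, (T - l1 ((j : ℕ) + 1)) * ((bump k n j : ℕ) : ℤ) =
      (T - l ((j : ℕ) + 1)) * ((bump k n j : ℕ) : ℤ) + if j = k then ((n k : ℤ) + 1) else 0 := by
      intro j
      rw [h1', hb]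
      by_cases hj : j = k
      · subst hj; simp; ring
      · simp [hj]
    simp only [this, Finset.sum_add_distrib, Finset.sum_ite_eq', Finset.mem_univ, if_true]
  have ex2 : ∑ j : Fin ν, (T - l ((j : ℕ) + 1)) * ((bump k n j : ℕ) : ℤ) +
      2 * SS n ((k : ℕ) + 1) =
      ∑ j : Fin ν, (T - l2 ((j : ℕ) + 1)) * (n j : ℤ) + (T - l ((k : ℕ) + 1)) := by
    have : ∀ j : Fin ν, (T - l ((j : ℕ) + 1)) * ((bump k n j : ℕ) : ℤ) =
      (T - l ((j : ℕ) + 1)) * (n j : ℤ) + if j = k then (T - l ((k : ℕ) + 1)) else 0 := by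
      intro j
      rw [hb]
      by_cases hj : j = k
      · subst hj; simp; ring
      · simp [hj]
    simp only [this, Finset.sum_add_distrib, Finset.sum_ite_eq', Finset.mem_univ, if_true]
    rw [SS_eq, Finset.mul_sum, add_right_comm, ← Finset.sum_add_distrib]
    congr 1
    apply Finset.sum_congr rfl
    intro j _
    rw [h2', min_comm (((k : ℕ) + 1 : ℕ) : ℤ)]
    push_cast
    ring
  rw [tm, tm, tm, ex1, sq_bump]
  rw [← Finset.mul_prod_erase Finset.univ _ (Finset.mem_univ k),
    ← Finset.mul_prod_erase Finset.univ _ (Finset.mem_univ k),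
    ← Finset.mul_prod_erase Finset.univ _ (Finset.mem_univ k)]
  have p1 : ∏ i ∈ Finset.univ.erase k, qB q (((bump k n i : ℕ) : ℤ) + l ((i : ℕ) + 1) -
        2 * SS (bump k n) ((i : ℕ) + 1)) ((bump k n i : ℕ) : ℤ) =
      ∏ i ∈ Finset.univ.erase k, qB q ((n i : ℤ) + l2 ((i : ℕ) + 1) -
        2 * SS n ((i : ℕ) + 1)) (n i) := by
    apply Finset.prod_congr rfl
    intro i hi
    rw [hb, h2', SS_bump, if_neg (Finset.ne_of_mem_erase hi)]
    congr 1 <;> ring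
  have p2 : ∏ i ∈ Finset.univ.erase k, qB q (((bump k n i : ℕ) : ℤ) + l1 ((i : ℕ) + 1) -
        2 * SS (bump k n) ((i : ℕ) + 1)) ((bump k n i : ℕ) : ℤ) =
      ∏ i ∈ Finset.univ.erase k, qB q ((n i : ℤ) + l2 ((i : ℕ) + 1) -
        2 * SS n ((i : ℕ) + 1)) (n i) := by
    apply Finset.prod_congr rfl
    intro i hi
    rw [hb, h1', h2', SS_bump, if_neg (Finset.ne_of_mem_erase hi)]
    congr 1 <;> ring
  rw [p1, p2, hb, h1', h2', SS_bump, if_pos rfl]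
  have m1 : min (((k : ℕ) + 1 : ℕ) : ℤ) ((k : ℤ) + 1) = k + 1 := by push_cast; simp
  rw [m1]
  have pas := qB_pascal (q := q) hq
    ((n k : ℤ) + (l ((k : ℕ) + 1) - 2 * ((k : ℤ) + 1)) - 2 * SS n ((k : ℕ) + 1)) (n k + 1)
    (by omega)
  have a1 : (n k : ℤ) + 1 + l ((k : ℕ) + 1) - 2 * (SS n ((k : ℕ) + 1) + ((k : ℤ) + 1)) =
    (n k : ℤ) + (l ((k : ℕ) + 1) - 2 * ((k : ℤ) + 1)) - 2 * SS n ((k : ℕ) + 1) + 1 := by ring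
  have a2 : (n k : ℤ) + 1 + (l ((k : ℕ) + 1) - 1) - 2 * (SS n ((k : ℕ) + 1) + ((k : ℤ) + 1)) =
    (n k : ℤ) + (l ((k : ℕ) + 1) - 2 * ((k : ℤ) + 1)) - 2 * SS n ((k : ℕ) + 1) := by ring
  rw [a1, a2, pas, add_sub_cancel_right]
  generalize (∏ i ∈ Finset.univ.erase k, qB q ((n i : ℤ) + l2 ((i : ℕ) + 1) -
        2 * SS n ((i : ℕ) + 1)) (n i)) = R
  generalize ((∑ i ∈ Finset.Icc 1 ν, NN n i ^ 2 : ℕ) : ℤ) = A at *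
  have e1 : A + 2 * SS n ((k : ℕ) + 1) + ((k : ℕ) + 1) +
      (∑ j : Fin ν, (T - l ((j : ℕ) + 1)) * ((bump k n j : ℕ) : ℤ) + (n k + 1)) =
      (A + 2 * SS n ((k : ℕ) + 1) + ((k : ℕ) + 1) +
      ∑ j : Fin ν, (T - l ((j : ℕ) + 1)) * ((bump k n j : ℕ) : ℤ)) + (n k + 1) := by ring
  have e2 : A + 2 * SS n ((k : ℕ) + 1) + ((k : ℕ) + 1) +
      ∑ j : Fin ν, (T - l ((j : ℕ) + 1)) * ((bump k n j : ℕ) : ℤ) =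
      ((k : ℤ) + 1 + T - l ((k : ℕ) + 1)) +
        (A + ∑ j : Fin ν, (T - l2 ((j : ℕ) + 1)) * (n j : ℤ)) := by
    linarith
  rw [e1, e2, zpow_add₀ hq0 _ ((n k : ℤ) + 1), zpow_add₀ hq0 ((k : ℤ) + 1 + T - l ((k : ℕ) + 1))]
  ring

lemma tm_nobump (hq : ∀ n : ℕ, 1 - q ^ (n + 1) ≠ 0) (T : ℤ) {ν : ℕ} (k : Fin ν)
    (l l1 : ℕ → ℤ)
    (h1 : ∀ i, 1 ≤ i → i ≤ ν → l1 i = l i - if i = (k : ℕ) + 1 then 1 else 0)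
    (n : Fin ν → ℕ) (hn : n k = 0)
    (hc : (∀ i, 1 ≤ i → i ≤ ν → 2 * SS n i ≤ l i) → 2 * SS n ((k : ℕ) + 1) ≠ l ((k : ℕ) + 1)) :
    tm q T l n - tm q T l1 n = 0 := by
  have h1' : ∀ i : Fin ν, l1 ((i : ℕ) + 1) = l ((i : ℕ) + 1) - if i = k then 1 else 0 := by
    intro i; rw [h1 _ (by omega) (by omega)]; congr 2; simp [Fin.ext_iff]
  by_cases hall : ∀ i, 1 ≤ i → i ≤ ν → 2 * SS n i ≤ l i
  · have hk := hc hall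
    have hk2 := hall ((k : ℕ) + 1) (by omega) (by omega)
    rw [sub_eq_zero, tm, tm]
    congr 1
    · congr 2
      apply Finset.sum_congr rfl
      intro j _
      rw [h1']
      by_cases hj : j = k
      · subst hj; simp [hn]
      · simp [hj]
    · apply Finset.prod_congr rfl
      intro j _
      rw [h1']
      by_cases hj : j = k
      · subst hj
        rw [hn, if_pos rfl]
        have := qB_pascal (q := q) hq ((((0 : ℕ) : ℤ) + l ((j : ℕ) + 1) -
          2 * SS n ((j : ℕ) + 1)) - 1) ((0 : ℕ) : ℤ) (by omega)
        rw [sub_add_cancel, qB_of_not (k := ((0 : ℕ) : ℤ) - 1) (by omega)] at this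
        rw [this]
        simp
        congr 1; ring
      · simp [hj]
  · push Not at hall
    obtain ⟨i, hi1, hi2, hi⟩ := hall
    obtain ⟨j, rfl⟩ : ∃ j, i = j + 1 := ⟨i - 1, by omega⟩
    rw [tm_zero ⟨j, by omega⟩ hi, tm_zero ⟨j, by omega⟩, sub_zero]
    simp only
    rw [h1 _ hi1 hi2]
    split_ifs <;> omega

lemma Ph_key (hq0 : q ≠ 0) (hq : ∀ n : ℕ, 1 - q ^ (n + 1) ≠ 0) (T : ℤ) {ν : ℕ} (k : ℕ)
    (hk1 : 1 ≤ k) (hk2 : k ≤ ν) (l l1 l2 : ℕ → ℤ)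
    (h1 : ∀ i, 1 ≤ i → i ≤ ν → l1 i = l i - if i = k then 1 else 0)
    (h2 : ∀ i, 1 ≤ i → i ≤ ν → l2 i = l i - 2 * min (i : ℤ) k)
    (hc : ∀ n : Fin ν → ℕ, NN n k = NN n (k + 1) →
      (∀ i, 1 ≤ i → i ≤ ν → 2 * SS n i ≤ l i) → 2 * SS n k ≠ l k) :
    Ph q T ν l - Ph q T ν l1 = q ^ ((k : ℤ) + T - l k) * Ph q T ν l2 := by
  obtain ⟨k, rfl⟩ : ∃ j, k = j + 1 := ⟨k - 1, by omega⟩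
  have hν : 1 ≤ ν := by omega
  set κ : Fin ν := ⟨k, by omega⟩ with hκ
  rw [Ph, Ph, ← finsum_sub_distrib (tm_fin T hν l) (tm_fin T hν l1)]
  have hsupp : Function.support (fun n : Fin ν → ℕ => tm q T l n - tm q T l1 n) ⊆
      Set.range (bump κ) := by
    intro n hn
    by_contra hcon
    apply hn
    have hz : n κ = 0 := by
      by_contra hz; exact hcon (mem_bump κ n hz)
    apply tm_nobump hq T κ l l1 h1 n hz
    apply hc n
    have := NN_step n κ
    rw [hz, zero_add] at this
    exact this
  have hA : ∑ᶠ n : Fin ν → ℕ, (tm q T l n - tm q T l1 n) =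
      ∑ᶠ n ∈ Set.range (bump κ), (tm q T l n - tm q T l1 n) := by
    rw [← finsum_mem_univ]
    apply finsum_mem_inter_support_eq
    rw [Set.univ_inter, Set.inter_eq_right.mpr hsupp]
  rw [hA, finsum_mem_range (bump_inj κ)]
  have hB : ∀ n : Fin ν → ℕ, tm q T l (bump κ n) - tm q T l1 (bump κ n) =
      q ^ (((k + 1 : ℕ) : ℤ) + T - l (k + 1)) * tm q T l2 n := by
    intro n
    have := tm_bump hq0 hq T κ l l1 l2 h1 (by intro i a b; rw [h2 i a b]; simp [hκ]) n
    rw [this]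
    simp [hκ]
  simp only [hB]
  rw [Ph, mul_finsum]

end helpers

section recur

variable {F : Type*} [Field F] {q : F}

lemma tele_up (G r : ℕ → F) (a b : ℕ) (hab : a ≤ b)
    (h : ∀ j, a ≤ j → j < b → G j - G (j + 1) = r j) :
    G a - G b = ∑ j ∈ Finset.Ico a b, r j := by
  induction b, hab using Nat.le_induction with
  | base => simp
  | succ b hb ih =>
    rw [Finset.sum_Ico_succ_top hb, ← ih (fun j h1 h2 => h j h1 (by omega)),
      ← h b hb (by omega)]
    ring

def Qs (q : F) (T : ℤ) (ν σ : ℕ) (L : ℤ) : F :=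
  Ph q T ν (fun i => L - max 0 ((i : ℤ) - σ))

def shA (σ : ℕ) (L : ℤ) (k i : ℕ) : ℤ :=
  (if i < k then L - 1 else L - max 0 ((i : ℤ) - σ)) - 2 * min (i : ℤ) k

lemma tele1 (hq0 : q ≠ 0) (hq : ∀ n : ℕ, 1 - q ^ (n + 1) ≠ 0) (T : ℤ) {ν : ℕ} (σ : ℕ) (L : ℤ)
    (hσ : σ ≤ ν) (hL : 1 ≤ L ∨ σ < ν) :
    Qs q T ν σ L - Qs q T ν (σ + 1) (L - 1) =
      ∑ k ∈ Finset.Ico 1 (σ + 1), q ^ ((k : ℤ) + T - L) * Ph q T ν (shA σ L k) := by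
  rw [← tele_up (fun k => Ph q T ν
    (fun i => if i < k then L - 1 else L - max 0 ((i : ℤ) - σ))) _ 1 (σ + 1) (by omega)]
  · congr 1
    · apply Ph_congr
      intro i h1 h2
      split_ifs <;> push_cast <;> omega
  · intro k hk1 hk2
    have hlk : (if k < k then L - 1 else L - max 0 ((k : ℤ) - σ)) = L := by
      rw [if_neg (by omega)]; omega
    rw [Ph_key hq0 hq T k hk1 (by omega) (l2 := shA σ L k), hlk]
    · intro i h1 h2
      split_ifs <;> omega
    · intro i h1 h2
      simp only [shA]
    · intro n hn hall heq
      rw [hlk] at heq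
      have hS := SS_succ n k
      have hS0 := SS_succ n (k - 1)
      have e : k - 1 + 1 = k := by omega
      rw [e] at hS0
      have hN1 : NN n (k + 1) = 0 := by
        by_cases hkν : k + 1 ≤ ν
        · have := hall (k + 1) (by omega) hkν
          rw [if_neg (by omega)] at this
          omega
        · exact NN_top n _ (by omega)
      rw [hn, hN1] at hS0
      by_cases hk : k = 1
      · subst hk
        rw [SS_zero] at hS0
        have h3 := hall ν (by omega) le_rfl
        have h4 := SS_nonneg n ν
        rw [if_neg (by omega)] at h3
        push_cast at *
        omega
      · have := hall (k - 1) (by omega) (by omega)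
        rw [if_pos (by omega)] at this
        push_cast at *
        omega

/-- doubly lowered shape -/
def shE (τ : ℕ) (L : ℤ) (j k i : ℕ) : ℤ :=
  if i < j then L - 2 - 4 * i else if i ≤ k then L - 1 - 2 * i - 2 * j else
    L - max 0 ((i : ℤ) - τ - 1) - 2 - 2 * k - 2 * j

def shC (τ : ℕ) (L : ℤ) (k i : ℕ) : ℤ :=
  if i < k then L - 2 - 2 * i else if i = k then L - 1 - 2 * i else
    L - max 0 ((i : ℤ) - τ - 1) - 2 - 2 * k

lemma teleA (hq0 : q ≠ 0) (hq : ∀ n : ℕ, 1 - q ^ (n + 1) ≠ 0) (T : ℤ) {ν : ℕ} (τ : ℕ) (L : ℤ)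
    (hτ : τ + 1 ≤ ν) (k : ℕ) (hk1 : 1 ≤ k) (hk2 : k ≤ τ) :
    Ph q T ν (shA (τ + 1) L (k + 1)) - Ph q T ν (shC τ L k) =
      ∑ j ∈ Finset.Ico 1 k, q ^ (3 * (j : ℤ) + (T - L + 1)) * Ph q T ν (shE τ L j k) := by
  rw [← tele_up (fun j => Ph q T ν
    (fun i => if i < j then L - 2 - 2 * i else if i ≤ k then L - 1 - 2 * i else
      L - max 0 ((i : ℤ) - τ - 1) - 2 - 2 * k)) _ 1 k (by omega)]
  · congr 1
    · apply Ph_congr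
      intro i h1 h2
      simp only [shA]
      split_ifs <;> push_cast <;> omega
    · apply Ph_congr
      intro i h1 h2
      simp only [shC]
      split_ifs <;> push_cast <;> omega
  · intro j hj1 hj2
    rw [Ph_key hq0 hq T j hj1 (by omega) (l2 := shE τ L j k)]
    · congr 2
      rw [if_neg (by omega), if_pos (by omega)]; ring
    · intro i h1 h2
      split_ifs <;> omega
    · intro i h1 h2
      simp only [shE]
      split_ifs <;> omega
    · intro n hn hall heq
      have h3 := hall (j + 1) (by omega) (by omega)
      have hS := SS_succ n j
      rw [if_neg (by omega), if_pos (by omega)] at heq h3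
      push_cast at *
      omega

lemma teleB (hq0 : q ≠ 0) (hq : ∀ n : ℕ, 1 - q ^ (n + 1) ≠ 0) (T : ℤ) {ν : ℕ} (τ : ℕ) (L : ℤ)
    (hτ : τ + 1 ≤ ν) (k : ℕ) (hk1 : 1 ≤ k) (hk2 : k ≤ τ) :
    Ph q T ν (shA τ (L - 1) k) - Ph q T ν (shC τ L k) =
      ∑ j ∈ Finset.Ico (k + 1) (τ + 1),
        q ^ ((j : ℤ) + 2 * k + (T - L + 1)) * Ph q T ν (shE τ L k j) := by
  have := tele_up (fun j => - Ph q T ν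
    (fun i => if i < k then L - 2 - 2 * i else if i < j then L - 1 - 2 * k else
      L - max 0 ((i : ℤ) - τ - 1) - 2 - 2 * k))
      (fun j => q ^ ((j : ℤ) + 2 * k + (T - L + 1)) * Ph q T ν (shE τ L k j))
      (k + 1) (τ + 1) (by omega) ?_
  · rw [← this, sub_neg_eq_add, neg_add_eq_sub]
    congr 1
    · apply Ph_congr
      intro i h1 h2
      simp only [shA]
      split_ifs <;> push_cast <;> omega
    · apply Ph_congr
      intro i h1 h2
      simp only [shC]
      split_ifs <;> push_cast <;> omega
  · intro j hj1 hj2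
    rw [sub_neg_eq_add, neg_add_eq_sub,
      Ph_key hq0 hq T j (by omega) (by omega) (l2 := shE τ L k j)]
    · congr 2
      rw [if_neg (by omega), if_pos (by omega)]; ring
    · intro i h1 h2
      split_ifs <;> omega
    · intro i h1 h2
      simp only [shE]
      split_ifs <;> omega
    · intro n hn hall heq
      have h3 := hall (j + 1) (by omega) (by omega)
      have hS := SS_succ n j
      rw [if_neg (by omega), if_pos (by omega)] at heq
      rw [if_neg (by omega), if_neg (by omega)] at h3
      push_cast at *
      omega

lemma cancelAB (hq0 : q ≠ 0) (hq : ∀ n : ℕ, 1 - q ^ (n + 1) ≠ 0) (T : ℤ) {ν : ℕ} (τ : ℕ) (L : ℤ)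
    (hτ : τ + 1 ≤ ν) :
    ∑ k ∈ Finset.Ico 1 (τ + 1), q ^ ((k : ℤ) + 1 + T - L) * Ph q T ν (shA (τ + 1) L (k + 1)) =
    ∑ k ∈ Finset.Ico 1 (τ + 1), q ^ ((k : ℤ) + 1 + T - L) * Ph q T ν (shA τ (L - 1) k) := by
  have hA : ∀ k ∈ Finset.Ico 1 (τ + 1),
      q ^ ((k : ℤ) + 1 + T - L) * Ph q T ν (shA (τ + 1) L (k + 1)) =
      q ^ ((k : ℤ) + 1 + T - L) * Ph q T ν (shC τ L k) + ∑ j ∈ Finset.Ico 1 k,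
        q ^ ((k : ℤ) + 3 * j + 2 * (T - L + 1)) * Ph q T ν (shE τ L j k) := by
    intro k hk
    rw [Finset.mem_Ico] at hk
    rw [sub_eq_iff_eq_add'.mp (teleA hq0 hq T τ L hτ k hk.1 (by omega)), mul_add, Finset.mul_sum]
    congr 1
    apply Finset.sum_congr rfl
    intro j _
    rw [← mul_assoc, ← zpow_add₀ hq0]
    congr 2; ring
  have hB : ∀ k ∈ Finset.Ico 1 (τ + 1),
      q ^ ((k : ℤ) + 1 + T - L) * Ph q T ν (shA τ (L - 1) k) =
      q ^ ((k : ℤ) + 1 + T - L) * Ph q T ν (shC τ L k) + ∑ j ∈ Finset.Ico (k + 1) (τ + 1),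
        q ^ ((j : ℤ) + 3 * k + 2 * (T - L + 1)) * Ph q T ν (shE τ L k j) := by
    intro k hk
    rw [Finset.mem_Ico] at hk
    rw [sub_eq_iff_eq_add'.mp (teleB hq0 hq T τ L hτ k hk.1 (by omega)), mul_add, Finset.mul_sum]
    congr 1
    apply Finset.sum_congr rfl
    intro j _
    rw [← mul_assoc, ← zpow_add₀ hq0]
    congr 2; ring
  rw [Finset.sum_congr rfl hA, Finset.sum_congr rfl hB, Finset.sum_add_distrib,
    Finset.sum_add_distrib]
  congr 1
  apply Finset.sum_comm'
  intro x y
  simp only [Finset.mem_Ico]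
  omega

lemma Qs_rec (hq0 : q ≠ 0) (hq : ∀ n : ℕ, 1 - q ^ (n + 1) ≠ 0) (T : ℤ) {ν : ℕ} (τ : ℕ) (L : ℤ)
    (hτ : τ + 1 ≤ ν) (hL : 1 ≤ L) :
    Qs q T ν (τ + 1) L = Qs q T ν (τ + 2) (L - 1) + Qs q T ν τ (L - 1)
      - (1 - q ^ (1 + T - L)) * Qs q T ν (τ + 1) (L - 2) := by
  have h1 := tele1 hq0 hq T (τ + 1) L hτ (Or.inl hL)
  have h2 := tele1 hq0 hq T (ν := ν) τ (L - 1) (by omega) (Or.inr (by omega))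
  have h3 := cancelAB hq0 hq T τ L hτ
  rw [Finset.sum_eq_sum_Ico_succ_bot (by omega), ← Finset.sum_Ico_add' _ 1 (τ + 1) 1] at h1
  have h4 : Ph q T ν (shA (τ + 1) L 1) = Qs q T ν (τ + 1) (L - 2) := by
    apply Ph_congr
    intro i h1 h2
    simp only [shA]
    rw [if_neg (by omega)]
    push_cast
    omega
  rw [h4] at h1
  have e : ∀ k : ℕ, (k : ℤ) + T - (L - 1) = k + 1 + T - L := by intro k; ring
  simp only [e] at h2
  push_cast at h1
  have e2 : L - 1 - 1 = L - 2 := by ring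
  rw [e2] at h2
  rw [h3, ← h2] at h1
  have e3 : τ + 1 + 1 = τ + 2 := rfl
  rw [e3] at h1
  linear_combination h1

lemma Qs_zero (T : ℤ) {ν : ℕ} (L : ℤ) : Qs q T ν 0 L = Qs q T ν 1 (L - 1) := by
  apply Ph_congr
  intro i h1 h2
  push_cast
  omega

lemma Qs_top (T : ℤ) {ν : ℕ} (L : ℤ) : Qs q T ν (ν + 1) L = Qs q T ν ν L := by
  apply Ph_congr
  intro i h1 h2
  push_cast
  omega

lemma Qs_neg (T : ℤ) {ν : ℕ} (hν : 1 ≤ ν) (σ : ℕ) (L : ℤ) (hL : L < 0) : Qs q T ν σ L = 0 := by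
  apply Ph_neg T 1 le_rfl hν
  omega

lemma Qs_len0 (T : ℤ) {ν : ℕ} (hν : 1 ≤ ν) (σ : ℕ) (h : σ < ν) : Qs q T ν σ 0 = 0 := by
  apply Ph_neg T ν hν le_rfl
  omega

lemma Qs_len0_top (T : ℤ) {ν : ℕ} (hν : 1 ≤ ν) : Qs q T ν ν 0 = 1 := by
  rw [Qs, Ph, finsum_eq_single _ (0 : Fin ν → ℕ)]
  · have hN : ∀ i, NN (0 : Fin ν → ℕ) i = 0 := by intro i; simp [NN]
    have hS : ∀ i, SS (0 : Fin ν → ℕ) i = 0 := by intro i; simp [SS, hN]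
    have hB : qB q 0 0 = 1 := by simp [qB, qP]
    have hm : ∀ i : Fin ν, max (0 : ℤ) (((i : ℕ) : ℤ) + 1 - ν) = 0 := by intro i; omega
    simp [tm, hN, hS, hB]
  · intro n hn
    obtain ⟨k, hk⟩ : ∃ k, n k ≠ 0 := by
      by_contra hc; push Not at hc; exact hn (funext hc)
    have := le_SS n k
    apply tm_zero ⟨ν - 1, by omega⟩
    have e : (⟨ν - 1, by omega⟩ : Fin ν).val + 1 = ν := by simp; omega
    rw [e]
    omega

end recur

section bosonic

variable {F : Type*} [Field F] {q : F}

lemma fs_fin (c : ℤ → F) (L x p : ℤ) (hp : 0 < p) :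
    Function.HasFiniteSupport (fun j : ℤ => c j * qB q L (x + j * p)) := by
  apply Set.Finite.subset (Set.finite_Icc (-(|L| + |x|)) (|L| + |x|))
  intro j hj
  by_contra hc
  apply hj
  simp only
  rw [qB_of_not, mul_zero]
  rintro ⟨h1, h2⟩
  apply hc
  have hL := le_abs_self L
  have hx := le_abs_self x
  have hx' := neg_abs_le x
  have hL0 := abs_nonneg L
  rw [Set.mem_Icc]
  constructor
  · by_contra h
    push Not at h
    nlinarith [abs_nonneg x]
  · by_contra h
    push Not at h
    nlinarith [abs_nonneg x]

lemma B_split (ν : ℕ) (s b : ℤ) (L : ℕ) : B ν s b L q =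
    (∑ᶠ j : ℤ, q ^ (j * ((2 * j + 1) * (2 * (ν : ℤ) + 3) - 2 * s)) *
        qB q (L : ℤ) (((L : ℤ) + b - s) / 2 + j * (2 * (ν : ℤ) + 3))) -
    ∑ᶠ j : ℤ, q ^ ((2 * j + 1) * ((2 * (ν : ℤ) + 3) * j + s)) *
        qB q (L : ℤ) (((L : ℤ) + b + s) / 2 + j * (2 * (ν : ℤ) + 3)) := by
  rw [B, finsum_sub_distrib]
  · exact fs_fin _ _ _ _ (by positivity)
  · exact fs_fin _ _ _ _ (by positivity)

lemma qB_three' (hq0 : q ≠ 0) (hq : ∀ n : ℕ, 1 - q ^ (n + 1) ≠ 0) (m : ℕ) (x y p j : ℤ)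
    (hx : (((m + 1 : ℕ) : ℤ) + x) % 2 = 0) :
    qB q ((m + 1 : ℕ) : ℤ) ((((m + 1 : ℕ) : ℤ) + x) / 2 + j * p) =
    qB q (m : ℤ) (((m : ℤ) + (x - 1)) / 2 + j * p) + qB q (m : ℤ) (((m : ℤ) + (x + 1)) / 2 + j * p)
    - (1 - q ^ m) * qB q ((m - 1 : ℕ) : ℤ) ((((m - 1 : ℕ) : ℤ) + x) / 2 + j * p) := by
  obtain ⟨t, ht⟩ : ∃ t, x = 2 * t - (m + 1) := ⟨((m : ℤ) + 1 + x) / 2, by push_cast at hx; omega⟩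
  have e1 : (((m + 1 : ℕ) : ℤ) + x) / 2 = t := by push_cast; omega
  have e2 : ((m : ℤ) + (x - 1)) / 2 = t - 1 := by omega
  have e3 : ((m : ℤ) + (x + 1)) / 2 = t := by omega
  rw [e1, e2, e3]
  have h := qB_three hq0 hq m (t + j * p)
  push_cast
  rw [h]
  have e5 : t + j * p - 1 = t - 1 + j * p := by ring
  rw [e5]
  rcases m with _ | m
  · simp
  · have e4 : (((m + 1 - 1 : ℕ) : ℤ) + x) / 2 = t - 1 := by push_cast at *; omega
    rw [e4]

lemma B_rec (hq0 : q ≠ 0) (hq : ∀ n : ℕ, 1 - q ^ (n + 1) ≠ 0) (ν : ℕ) (s b : ℤ) (m : ℕ)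
    (hp : ((m : ℤ) + 1 + b + s) % 2 = 0) :
    B ν s b (m + 1) q = B ν s (b - 1) m q + B ν s (b + 1) m q -
      (1 - q ^ m) * B ν s b (m - 1) q := by
  have hfin : ∀ (s b : ℤ) (m : ℕ), Function.HasFiniteSupport (fun j : ℤ =>
    (q ^ (j * ((2 * j + 1) * (2 * (ν : ℤ) + 3) - 2 * s)) *
        qB q (m : ℤ) (((m : ℤ) + b - s) / 2 + j * (2 * (ν : ℤ) + 3)) -
      q ^ ((2 * j + 1) * ((2 * (ν : ℤ) + 3) * j + s)) *
        qB q (m : ℤ) (((m : ℤ) + b + s) / 2 + j * (2 * (ν : ℤ) + 3)))) := by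
    intro s b m
    apply Function.HasFiniteSupport.fun_sub
    · exact fs_fin _ _ _ _ (by positivity)
    · exact fs_fin _ _ _ _ (by positivity)
  simp only [B]
  rw [mul_finsum, ← finsum_add_distrib (hfin _ _ _) (hfin _ _ _), ← finsum_sub_distrib]
  · apply finsum_congr
    intro j
    have h1 := qB_three' hq0 hq m (b - s) 0 (2 * (ν : ℤ) + 3) j (by push_cast; omega)
    have h2 := qB_three' hq0 hq m (b + s) 0 (2 * (ν : ℤ) + 3) j (by push_cast; omega)
    rw [show ((m + 1 : ℕ) : ℤ) + b - s = ((m + 1 : ℕ) : ℤ) + (b - s) by ring,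
      show ((m + 1 : ℕ) : ℤ) + b + s = ((m + 1 : ℕ) : ℤ) + (b + s) by ring,
      show ((m - 1 : ℕ) : ℤ) + b - s = ((m - 1 : ℕ) : ℤ) + (b - s) by ring,
      show ((m - 1 : ℕ) : ℤ) + b + s = ((m - 1 : ℕ) : ℤ) + (b + s) by ring,
      show (m : ℤ) + (b - 1) - s = (m : ℤ) + (b - s - 1) by ring,
      show (m : ℤ) + (b - 1) + s = (m : ℤ) + (b + s - 1) by ring,
      show (m : ℤ) + (b + 1) - s = (m : ℤ) + (b - s + 1) by ring,
      show (m : ℤ) + (b + 1) + s = (m : ℤ) + (b + s + 1) by ring, h1, h2]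
    ring
  · exact (hfin _ _ _).fun_add (hfin _ _ _)
  · exact Set.Finite.subset (hfin s b (m - 1)) (fun j hj => right_ne_zero_of_mul hj)

lemma B_symm (ν : ℕ) (s b : ℤ) (m : ℕ) (hp : ((m : ℤ) + b + s) % 2 = 0) :
    B ν s b m q = B ν (2 * (ν : ℤ) + 3 - s) (2 * (ν : ℤ) + 3 - b) m q := by
  rw [B_split, B_split]
  congr 1
  · rw [← finsum_comp_equiv (Equiv.neg ℤ)]
    apply finsum_congr
    intro j
    rw [qB_symm]
    simp only [Equiv.neg_apply]
    congr 2
    · ring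
    · have e : ((m : ℤ) + (2 * (ν : ℤ) + 3 - b) - (2 * (ν : ℤ) + 3 - s)) / 2 =
        m - ((m : ℤ) + b - s) / 2 := by omega
      rw [e]; ring
  · rw [← finsum_comp_equiv (Equiv.subLeft (-1 : ℤ))]
    apply finsum_congr
    intro j
    rw [qB_symm]
    simp only [Equiv.subLeft_apply]
    congr 2
    · ring
    · have e : ((m : ℤ) + (2 * (ν : ℤ) + 3 - b) + (2 * (ν : ℤ) + 3 - s)) / 2 =
        m - ((m : ℤ) + b + s) / 2 + (2 * ν + 3) := by omega
      rw [e]; ring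

lemma B_bdry (hq0 : q ≠ 0) (hq : ∀ n : ℕ, 1 - q ^ (n + 1) ≠ 0) (ν : ℕ) (s : ℤ) (m : ℕ)
    (hp : ((m : ℤ) + s) % 2 = 0) :
    B ν s 1 (m + 1) q = B ν s 2 m q := by
  have hpos : (0 : ℤ) < 2 * (ν : ℤ) + 3 := by positivity
  obtain ⟨t, ht⟩ : ∃ t, s = 2 * t - m := ⟨((m : ℤ) + s) / 2, by omega⟩
  rw [B_split, B_split]
  have e1 : (((m + 1 : ℕ) : ℤ) + 1 - s) / 2 = t + 1 - s := by push_cast; omega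
  have e2 : (((m + 1 : ℕ) : ℤ) + 1 + s) / 2 = t + 1 := by push_cast; omega
  have e3 : ((m : ℤ) + 2 - s) / 2 = t + 1 - s := by omega
  have e4 : ((m : ℤ) + 2 + s) / 2 = t + 1 := by omega
  rw [e1, e2, e3, e4]
  have hpas : ∀ k : ℤ, qB q ((m + 1 : ℕ) : ℤ) k =
      qB q m k + q ^ ((m : ℤ) + 1 - k) * qB q m (k - 1) := by
    intro k
    have := qB_pascal' (q := q) hq (m : ℤ) k (by omega)
    push_cast
    exact this
  have hA : ∀ j : ℤ, q ^ (j * ((2 * j + 1) * (2 * (ν : ℤ) + 3) - 2 * s)) *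
        qB q ((m + 1 : ℕ) : ℤ) (t + 1 - s + j * (2 * (ν : ℤ) + 3)) =
      q ^ (j * ((2 * j + 1) * (2 * (ν : ℤ) + 3) - 2 * s)) *
        qB q (m : ℤ) (t + 1 - s + j * (2 * (ν : ℤ) + 3)) +
      q ^ (2 * (2 * (ν : ℤ) + 3) * j ^ 2 - 2 * s * j + t) *
        qB q (m : ℤ) (t - s + j * (2 * (ν : ℤ) + 3)) := by
    intro j
    rw [hpas, mul_add, ← mul_assoc, ← zpow_add₀ hq0]
    congr 3
    · rw [ht]; ring
    · ring
  have hB : ∀ j : ℤ, q ^ ((2 * j + 1) * ((2 * (ν : ℤ) + 3) * j + s)) *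
        qB q ((m + 1 : ℕ) : ℤ) (t + 1 + j * (2 * (ν : ℤ) + 3)) =
      q ^ ((2 * j + 1) * ((2 * (ν : ℤ) + 3) * j + s)) *
        qB q (m : ℤ) (t + 1 + j * (2 * (ν : ℤ) + 3)) +
      q ^ (2 * (2 * (ν : ℤ) + 3) * j ^ 2 + 2 * s * j + t) *
        qB q (m : ℤ) (t + j * (2 * (ν : ℤ) + 3)) := by
    intro j
    rw [hpas, mul_add, ← mul_assoc, ← zpow_add₀ hq0]
    congr 3
    · rw [ht]; ring
    · ring
  simp only [hA, hB]
  rw [finsum_add_distrib (fs_fin _ _ _ _ hpos) (fs_fin _ _ _ _ hpos),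
    finsum_add_distrib (fs_fin _ _ _ _ hpos) (fs_fin _ _ _ _ hpos)]
  have hC : ∑ᶠ j : ℤ, q ^ (2 * (2 * (ν : ℤ) + 3) * j ^ 2 - 2 * s * j + t) *
        qB q (m : ℤ) (t - s + j * (2 * (ν : ℤ) + 3)) =
      ∑ᶠ j : ℤ, q ^ (2 * (2 * (ν : ℤ) + 3) * j ^ 2 + 2 * s * j + t) *
        qB q (m : ℤ) (t + j * (2 * (ν : ℤ) + 3)) := by
    rw [← finsum_comp_equiv (Equiv.neg ℤ)]
    apply finsum_congr
    intro j
    rw [qB_symm]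
    simp only [Equiv.neg_apply]
    congr 2
    · ring
    · rw [ht]; ring
  rw [hC]
  ring

lemma B_init (ν : ℕ) (s b : ℤ) (hx1 : -(2 * (ν : ℤ) + 3) < (b - s) / 2)
    (hx2 : (b - s) / 2 < (2 * (ν : ℤ) + 3)) (hy1 : 0 < (b + s) / 2)
    (hy2 : (b + s) / 2 < (2 * (ν : ℤ) + 3)) :
    B ν s b 0 q = if (b - s) / 2 = 0 then 1 else 0 := by
  have hqz : ∀ k : ℤ, qB q ((0 : ℕ) : ℤ) k = if k = 0 then 1 else 0 := by
    intro k
    split_ifs with h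
    · subst h; simp [qB, qP]
    · rw [qB_of_not (by push_cast; omega)]
  have hz : ∀ x j p : ℤ, -p < x → x < p → x + j * p = 0 → j = 0 := by
    intro x j p h1 h2 h3
    by_contra hj
    rcases lt_or_gt_of_ne hj with h | h
    · nlinarith
    · nlinarith
  rw [B_split]
  have hA : ∑ᶠ j : ℤ, q ^ ((2 * j + 1) * ((2 * (ν : ℤ) + 3) * j + s)) *
        qB q ((0 : ℕ) : ℤ) ((((0 : ℕ) : ℤ) + b + s) / 2 + j * (2 * (ν : ℤ) + 3)) = 0 := by
    refine (finsum_congr (g := fun _ : ℤ => (0 : F)) ?_).trans finsum_zero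
    intro j
    rw [hqz, if_neg, mul_zero]
    intro h
    simp only [Nat.cast_zero, zero_add] at h
    have := hz _ j _ (by omega) hy2 h
    subst this
    omega
  rw [hA, sub_zero, finsum_eq_single _ (0 : ℤ)]
  · rw [hqz]; simp
  · intro j hj
    rw [hqz, if_neg, mul_zero]
    intro h
    simp only [Nat.cast_zero, zero_add] at h
    exact hj (hz _ j _ hx1 hx2 h)

def Pf (q : F) (ν s σ m : ℕ) : F :=
  if (m + σ + 1 + s) % 2 = 0 then B ν s ((σ : ℤ) + 1) m q
  else B ν (2 * (ν : ℤ) + 3 - s) ((σ : ℤ) + 1) m q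

lemma Pf_rec (hq0 : q ≠ 0) (hq : ∀ n : ℕ, 1 - q ^ (n + 1) ≠ 0) (ν s τ m : ℕ) :
    Pf q ν s (τ + 1) (m + 1) = Pf q ν s (τ + 2) m + Pf q ν s τ m
      - (1 - q ^ m) * Pf q ν s (τ + 1) (m - 1) := by
  have key : ∀ s' : ℤ, ((m : ℤ) + 1 + ((τ + 1 : ℕ) + 1) + s') % 2 = 0 →
     B ν s' (((τ + 1 : ℕ) : ℤ) + 1) (m + 1) q = B ν s' (((τ + 2 : ℕ) : ℤ) + 1) m q +
       B ν s' ((τ : ℤ) + 1) m q - (1 - q ^ m) * B ν s' (((τ + 1 : ℕ) : ℤ) + 1) (m - 1) q := by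
    intro s' h
    rw [B_rec hq0 hq ν s' _ m h, add_comm (B ν s' _ m q)]
    congr 3 <;> push_cast <;> ring
  have hm : m = 0 ∨ 1 ≤ m := by omega
  simp only [Pf]
  by_cases h : (m + 1 + (τ + 1) + 1 + s) % 2 = 0
  · rw [if_pos h, if_pos (by omega), if_pos (by omega), key _ (by push_cast; omega)]
    rcases hm with rfl | hm
    · simp
    · rw [if_pos (by omega)]
  · rw [if_neg h, if_neg (by omega), if_neg (by omega), key _ (by push_cast; omega)]
    rcases hm with rfl | hm
    · simp
    · rw [if_neg (by omega)]

lemma Pf_bdry (hq0 : q ≠ 0) (hq : ∀ n : ℕ, 1 - q ^ (n + 1) ≠ 0) (ν s m : ℕ) :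
    Pf q ν s 0 (m + 1) = Pf q ν s 1 m := by
  simp only [Pf]
  by_cases h : (m + 1 + 0 + 1 + s) % 2 = 0
  · rw [if_pos h, if_pos (by omega)]
    exact B_bdry hq0 hq ν s m (by omega)
  · rw [if_neg h, if_neg (by omega)]
    exact B_bdry hq0 hq ν _ m (by omega)

lemma Pf_top (ν s m : ℕ) : Pf q ν s (ν + 1) m = Pf q ν s ν m := by
  simp only [Pf]
  by_cases h : (m + (ν + 1) + 1 + s) % 2 = 0
  · rw [if_pos h, if_neg (by omega), B_symm _ _ _ _ (by push_cast; omega)]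
    congr 1
    push_cast; ring
  · rw [if_neg h, if_pos (by omega), B_symm _ _ _ _ (by push_cast; omega)]
    congr 1 <;> push_cast <;> ring

lemma Pf_init (ν s σ : ℕ) (hs1 : 1 ≤ s) (hs2 : s ≤ ν + 1) (hσ : σ ≤ ν) :
    Pf q ν s σ 0 = if σ = s - 1 then 1 else 0 := by
  simp only [Pf]
  split_ifs with h1 h2 h2
  · rw [B_init _ _ _ (by omega) (by omega) (by omega) (by omega), if_pos (by omega)]
  · rw [B_init _ _ _ (by omega) (by omega) (by omega) (by omega), if_neg (by omega)]
  · omega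
  · rw [B_init _ _ _ (by omega) (by omega) (by omega) (by omega), if_neg (by omega)]

end bosonic

section pairing

variable {F : Type*} [Field F] {q : F}

def Ipair (q : F) (ν : ℕ) (P Q : ℕ → ℕ → F) (m : ℕ) : F :=
  ∑ σ ∈ Finset.range (ν + 1), P σ m * Q σ m -
    (1 - q ^ m) * ∑ τ ∈ Finset.range ν, P (τ + 1) (m - 1) * Q (τ + 1) (m + 1)

lemma Ipair_step (ν : ℕ) (P Q : ℕ → ℕ → F) (m : ℕ)
    (hP0 : P 0 (m + 1) = P 1 m)
    (hP : ∀ τ, τ < ν → P (τ + 1) (m + 1) = P (τ + 2) m + P τ m - (1 - q ^ m) * P (τ + 1) (m - 1))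
    (hPt : P (ν + 1) m = P ν m)
    (hQ0 : Q 0 m = Q 1 (m + 1))
    (hQ : ∀ τ, τ < ν → Q (τ + 1) m = Q (τ + 2) (m + 1) + Q τ (m + 1)
      - (1 - q ^ (m + 1)) * Q (τ + 1) (m + 2))
    (hQt : Q (ν + 1) (m + 1) = Q ν (m + 1)) :
    Ipair q ν P Q m = Ipair q ν P Q (m + 1) := by
  have a1 : ∑ τ ∈ Finset.range ν, P (τ + 1) m * Q (τ + 1) m =
      ∑ τ ∈ Finset.range ν, P (τ + 1) m * Q (τ + 2) (m + 1) +
      ∑ τ ∈ Finset.range ν, P (τ + 1) m * Q τ (m + 1) -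
      (1 - q ^ (m + 1)) * ∑ τ ∈ Finset.range ν, P (τ + 1) m * Q (τ + 1) (m + 2) := by
    rw [Finset.mul_sum, ← Finset.sum_add_distrib, ← Finset.sum_sub_distrib]
    apply Finset.sum_congr rfl
    intro τ h
    rw [hQ τ (Finset.mem_range.mp h)]; ring
  have a2 : ∑ τ ∈ Finset.range ν, P (τ + 1) (m + 1) * Q (τ + 1) (m + 1) =
      ∑ τ ∈ Finset.range ν, P (τ + 2) m * Q (τ + 1) (m + 1) +
      ∑ τ ∈ Finset.range ν, P τ m * Q (τ + 1) (m + 1) -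
      (1 - q ^ m) * ∑ τ ∈ Finset.range ν, P (τ + 1) (m - 1) * Q (τ + 1) (m + 1) := by
    rw [Finset.mul_sum, ← Finset.sum_add_distrib, ← Finset.sum_sub_distrib]
    apply Finset.sum_congr rfl
    intro τ h
    rw [hP τ (Finset.mem_range.mp h)]; ring
  have a3 := Finset.sum_range_succ' (fun τ => P τ m * Q (τ + 1) (m + 1)) ν
  have a4 := Finset.sum_range_succ (fun τ => P τ m * Q (τ + 1) (m + 1)) ν
  have a5 := Finset.sum_range_succ' (fun τ => P (τ + 1) m * Q τ (m + 1)) ν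
  have a6 := Finset.sum_range_succ (fun τ => P (τ + 1) m * Q τ (m + 1)) ν
  simp only [hPt, hQt, zero_add, add_assoc, Nat.reduceAdd] at a3 a4 a5 a6
  simp only [Ipair, Nat.add_sub_cancel, add_assoc, Nat.reduceAdd]
  rw [Finset.sum_range_succ' _ ν, Finset.sum_range_succ' _ ν, a1, a2, hP0, hQ0]
  linear_combination a4 - a3 + a5 - a6

theorem main_id (hq0 : q ≠ 0) (hq : ∀ n : ℕ, 1 - q ^ (n + 1) ≠ 0) (ν : ℕ) (hν : 1 ≤ ν) (s : ℕ)
    (hs1 : 1 ≤ s) (hs2 : s ≤ ν + 1) (L : ℕ) :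
    Qs q L ν (s - 1) L = Pf q ν s ν L := by
  set P : ℕ → ℕ → F := fun σ m => Pf q ν s σ m with hPd
  set Q : ℕ → ℕ → F := fun σ m => Qs q L ν σ ((L : ℤ) - m) with hQd
  have hconst : ∀ m, m ≤ L → Ipair q ν P Q 0 = Ipair q ν P Q m := by
    intro m
    induction m with
    | zero => intro _; rfl
    | succ m ih =>
      intro hm
      rw [ih (by omega)]
      apply Ipair_step
      · exact Pf_bdry hq0 hq ν s m
      · intro τ _; exact Pf_rec hq0 hq ν s τ m
      · exact Pf_top ν s m
      · simp only [hQd]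
        rw [Qs_zero]; congr 1; push_cast; ring
      · intro τ hτ
        simp only [hQd]
        rw [Qs_rec hq0 hq L τ _ (by omega) (by omega)]
        have e1 : (L : ℤ) - m - 1 = L - ((m + 1 : ℕ) : ℤ) := by push_cast; ring
        have e2 : (L : ℤ) - m - 2 = L - ((m + 2 : ℕ) : ℤ) := by push_cast; ring
        have e3 : 1 + (L : ℤ) - (L - m) = ((m + 1 : ℕ) : ℤ) := by push_cast; ring
        rw [e1, e2, e3, zpow_natCast]
      · exact Qs_top _ _
  have h := hconst L le_rfl
  have hl : Ipair q ν P Q 0 = Qs q L ν (s - 1) L := by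
    simp only [Ipair, pow_zero, sub_self, zero_mul, sub_zero]
    rw [Finset.sum_eq_single (s - 1)]
    · simp only [hPd, hQd]
      rw [Pf_init _ _ _ hs1 hs2 (by omega), if_pos rfl]; simp
    · intro σ hσ hne
      simp only [hPd]
      rw [Finset.mem_range] at hσ
      rw [Pf_init _ _ _ hs1 hs2 (by omega), if_neg hne, zero_mul]
    · intro hh; exact absurd (Finset.mem_range.mpr (by omega)) hh
  have hr : Ipair q ν P Q L = Pf q ν s ν L := by
    rw [Ipair, Finset.sum_eq_zero (s := Finset.range ν), mul_zero, sub_zero,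
      Finset.sum_eq_single ν]
    · simp only [hPd, hQd, sub_self]
      rw [Qs_len0_top _ hν, mul_one]
    · intro σ hσ hne
      rw [Finset.mem_range] at hσ
      simp only [hQd, sub_self]
      rw [Qs_len0 _ hν σ (by omega), mul_zero]
    · intro hh; exact absurd (Finset.mem_range.mpr (by omega)) hh
    · intro τ _
      simp only [hQd]
      rw [Qs_neg _ hν _ _ (by push_cast; omega), mul_zero]
  rw [← hl, h, hr]

lemma sum_NN {ν : ℕ} (n : Fin ν → ℕ) (σ : ℕ) :
    ((∑ i ∈ Finset.Icc (σ + 1) ν, NN n i : ℕ) : ℤ) =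
      ∑ k : Fin ν, max 0 (((k : ℕ) : ℤ) + 1 - σ) * n k := by
  simp only [NN]
  rw [Finset.sum_comm]
  push_cast
  apply Finset.sum_congr rfl
  intro k _
  rw [← Finset.sum_filter]
  have : (Finset.Icc (σ + 1) ν).filter (fun i => i ≤ (k : ℕ) + 1) =
      Finset.Icc (σ + 1) ((k : ℕ) + 1) := by
    ext i; simp only [Finset.mem_filter, Finset.mem_Icc]; omega
  rw [this, Finset.sum_const, nsmul_eq_mul, Nat.card_Icc]
  congr 1
  omega

lemma lhs_eq (q : F) (ν s L : ℕ) :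
    (∑ᶠ nn : Fin ν → ℕ, q ^ expAG ν (s - 1) nn *
        ∏ i : Fin ν, qB q
          ((nn i : ℤ) + (L : ℤ) - 2 * (∑ l ∈ Finset.Icc 1 ((i : ℕ) + 1), (NN nn l : ℤ)) -
            alph ((i : ℕ) + 1) (s - 1)) (nn i)) = Qs q L ν (s - 1) L := by
  rw [Qs, Ph]
  apply finsum_congr
  intro n
  rw [tm, expAG, ← zpow_natCast]
  congr 1
  · congr 1
    rw [Nat.cast_add, sum_NN]
    congr 1
    apply Finset.sum_congr rfl
    intro k _
    push_cast
    ring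
  · apply Finset.prod_congr rfl
    intro i _
    rw [SS, alph]
    congr 1
    push_cast
    ring

end pairing

lemma X_ne : (RatFunc.X : K) ≠ 0 := RatFunc.X_ne_zero

lemma X_pow_ne (n : ℕ) : 1 - (RatFunc.X : K) ^ (n + 1) ≠ 0 := by
  intro h
  have h1 : (Polynomial.X : Polynomial ℚ) ^ (n + 1) = 1 := by
    apply RatFunc.algebraMap_injective ℚ
    rw [map_pow, RatFunc.algebraMap_X, map_one]
    exact (sub_eq_zero.mp h).symm
  have h2 := congrArg (Polynomial.eval 0) h1
  simp at h2

theorem stmt_8 (ν : ℕ) (hν : 1 ≤ ν) (s : ℕ) (hs1 : 1 ≤ s) (hs2 : s ≤ ν + 1) (L : ℕ) :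
    (¬ (L : ℤ) ≡ (s : ℤ) + ν [ZMOD 2] →
      (∑ᶠ nn : Fin ν → ℕ, (RatFunc.X : K) ^ expAG ν (s - 1) nn *
        ∏ i : Fin ν, qB (RatFunc.X : K)
          ((nn i : ℤ) + (L : ℤ) - 2 * (∑ l ∈ Finset.Icc 1 ((i : ℕ) + 1), (NN nn l : ℤ)) -
            alph ((i : ℕ) + 1) (s - 1)) (nn i)) =
      B ν (s : ℤ) ((ν : ℤ) + 1) L RatFunc.X) ∧
    ((L : ℤ) ≡ (s : ℤ) + ν [ZMOD 2] →
      (∑ᶠ nn : Fin ν → ℕ, (RatFunc.X : K) ^ expAG ν (s - 1) nn *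
        ∏ i : Fin ν, qB (RatFunc.X : K)
          ((nn i : ℤ) + (L : ℤ) - 2 * (∑ l ∈ Finset.Icc 1 ((i : ℕ) + 1), (NN nn l : ℤ)) -
            alph ((i : ℕ) + 1) (s - 1)) (nn i)) =
      B ν (2 * (ν : ℤ) + 3 - s) ((ν : ℤ) + 1) L RatFunc.X) := by
  rw [lhs_eq, main_id X_ne X_pow_ne ν hν s hs1 hs2 L]
  constructor
  · intro h
    rw [Pf, if_pos]
    rw [Int.ModEq] at h
    omega
  · intro h
    rw [Pf, if_neg]
    rw [Int.ModEq] at h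
    omega

end
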